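/- For every j ∈ ℕ and every x ∈ ℝ, the j-th derivative of the Gaussian function x ↦ exp(−x²) satisfies |(d/dx)^j exp(−x²)| ≤ e·j!. -/

import Mathlib

/-- On the real axis, the iterated real derivatives of the real part of an entire function are the
real parts of its iterated complex derivatives. -/
theorem Differentiable.iteratedDeriv_re_comp_ofReal {f : ℂ → ℂ} (hf : Differentiable ℂ f) (n : ℕ) :
    iteratedDeriv n (fun y : ℝ => (f y).re) = fun y : ℝ => (iteratedDeriv n f y).re := by
  induction n with
  | zero => simp
  | succ n ih =>
    ext y
    rw [iteratedDeriv_succ, ih, iteratedDeriv_succ]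
    have hd : DifferentiableAt ℂ (iteratedDeriv n f) y :=
      (hf.contDiff (n := (n + 1 : ℕ))).differentiable_iteratedDeriv n (by norm_cast; omega) y
    exact hd.hasDerivAt.real_of_complex.deriv

/-- The function `exp (-z ^ 2)` is bounded by `e` on unit circles with real centers. -/
theorem Complex.norm_exp_neg_sq_le_of_mem_sphere (x : ℝ) {z : ℂ}
    (hz : z ∈ Metric.sphere (x : ℂ) 1) : ‖Complex.exp (-z ^ 2)‖ ≤ Real.exp 1 := by
  rw [Complex.norm_exp, Real.exp_le_exp]
  have him : |z.im| ≤ 1 := by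
    simpa [mem_sphere_iff_norm.1 hz] using Complex.abs_im_le_norm (z - x)
  have hsq : z.im ^ 2 ≤ 1 := (sq_le_one_iff_abs_le_one _).2 him
  simp only [sq, Complex.neg_re, Complex.mul_re] at hsq ⊢
  nlinarith [mul_self_nonneg z.re]

/-- Uniform derivative bound for the Gaussian: `|(d/dx)^j exp(−x²)| ≤ e·j!` for all `j` and `x`. -/
theorem stmt_17 (j : ℕ) (x : ℝ) :
    |iteratedDeriv j (fun y : ℝ => Real.exp (-y ^ 2)) x| ≤
      Real.exp 1 * (j.factorial : ℝ) := by
  have hf : Differentiable ℂ fun z : ℂ => Complex.exp (-z ^ 2) := by fun_prop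
  have hre : (fun y : ℝ => Real.exp (-y ^ 2)) =
      fun y : ℝ => (Complex.exp (-(y : ℂ) ^ 2)).re := by
    ext y
    rw [← Complex.exp_ofReal_re]
    push_cast
    rfl
  rw [hre, hf.iteratedDeriv_re_comp_ofReal j]
  refine (Complex.abs_re_le_norm _).trans ?_
  simpa [mul_comm] using Complex.norm_iteratedDeriv_le_of_forall_mem_sphere_norm_le j one_pos
    hf.diffContOnCl fun z hz => Complex.norm_exp_neg_sq_le_of_mem_sphere x hz
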